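/- Let a be a partial assignment of a QBC Φ = P:φ such that the instantiated QBC Φ[a] is false. Then clause(a) is an axiom of Φ, that is, every model of P:φ is a model of P:clause(a). -/

import Mathlib

/-! Framework for quantified Boolean circuits (QBCs), QU-resolution,
relaxations, and the prover–delayer game, following Chen,
"Proof Complexity Modulo the Polynomial Hierarchy". -/

/-- Quantifiers. -/
inductive Quant where
  | all : Quant
  | ex : Quant
deriving DecidableEq

/-- A partial assignment of Boolean values to (numbered) propositional
variables.  Via the correspondence `C ↔ assign(C)`, partial assignments also
represent clauses (the clause `clause(a)` is the unique clause with variable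
set `dom a` falsified by `a`); we freely identify the two. -/
abbrev PA : Type := ℕ → Option Bool

/-- The everywhere-undefined partial assignment (= the empty clause). -/
def emptyPA : PA := fun _ => none

/-- `g` extends the partial assignment `f`. -/
def ExtendsPA (g f : PA) : Prop := ∀ v b, f v = some b → g v = some b

/-- A total assignment `g` extends a partial assignment `f`; when `f`
represents a clause, this says `g` falsifies that clause. -/
def TotalExtends (g : ℕ → Bool) (f : PA) : Prop := ∀ v b, f v = some b → g v = b

/-- A partial assignment `r` satisfies a clause `C` (i.e. makes some literal
of `C` true). -/
def SatisfiedBy (r : PA) (C : PA) : Prop := ∃ v b, C v = some b ∧ r v = some (!b)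

/-- A quantified Boolean circuit: a quantifier prefix (a list of
quantifier/variable pairs) together with a Boolean function on total
assignments, represented as a predicate. -/
structure QBC where
  pfx : List (Quant × ℕ)
  matrix : (ℕ → Bool) → Prop

/-- The variables of the prefix of a QBC. -/
def QBC.vars (Φ : QBC) : List ℕ := Φ.pfx.map Prod.snd

/-- Well-formedness of a QBC: the prefix has no repeated variables, and the
matrix depends only on the values of the prefix variables. -/
def QBC.WellFormed (Φ : QBC) : Prop :=
  Φ.vars.Nodup ∧
  ∀ f g : ℕ → Bool, (∀ v ∈ Φ.vars, f v = g v) → (Φ.matrix f ↔ Φ.matrix g)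

/-- Standard semantics of a quantifier prefix over a matrix, starting from a
base assignment. -/
def evalQ : List (Quant × ℕ) → ((ℕ → Bool) → Prop) → (ℕ → Bool) → Prop
  | [], φ, g => φ g
  | (Quant.ex, v) :: P, φ, g => ∃ b, evalQ P φ (Function.update g v b)
  | (Quant.all, v) :: P, φ, g => ∀ b, evalQ P φ (Function.update g v b)

/-- Truth of a QBC. -/
def QBC.IsTrue (Φ : QBC) : Prop := ∀ g, evalQ Φ.pfx Φ.matrix g

/-- Falsity of a QBC. -/
def QBC.IsFalse (Φ : QBC) : Prop := ¬ Φ.IsTrue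

/-- The existentially quantified variables of a prefix. -/
def existVars (P : List (Quant × ℕ)) : List ℕ :=
  (P.filter fun p => decide (p.1 = Quant.ex)).map Prod.snd

/-- The universally quantified variables of a prefix. -/
def univVars (P : List (Quant × ℕ)) : List ℕ :=
  (P.filter fun p => decide (p.1 = Quant.all)).map Prod.snd

/-- The relation `u ⪯ v` of a prefix: `vᵢ ⪯ vⱼ` iff `i ≤ j`, or `j < i` and
`Qⱼ = Qⱼ₊₁ = ⋯ = Qᵢ`. -/
def preceq (P : List (Quant × ℕ)) (u v : ℕ) : Prop :=
  ∃ i j : ℕ, (P[i]?).map Prod.snd = some u ∧ (P[j]?).map Prod.snd = some v ∧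
    (i ≤ j ∨ (j < i ∧ ∀ k, j ≤ k → k ≤ i → (P[k]?).map Prod.fst = (P[j]?).map Prod.fst))

/-- `u` strictly precedes `v` (`u ⪯ v` and not `v ⪯ u`). -/
def strictPrec (P : List (Quant × ℕ)) (u v : ℕ) : Prop :=
  preceq P u v ∧ ¬ preceq P v u

/-- dom(f) ⪯ y : every variable on which `f` is defined is `⪯ y`. -/
def domPrec (P : List (Quant × ℕ)) (f : PA) (y : ℕ) : Prop :=
  ∀ u, f u ≠ none → preceq P u y

/-- An ∃-strategy: a family of response functions for the existential
variables, each depending only on the universal variables strictly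
preceding it. -/
def IsExStrategy (Φ : QBC) (σ : ℕ → (ℕ → Bool) → Bool) : Prop :=
  ∀ x ∈ existVars Φ.pfx, ∀ τ τ' : ℕ → Bool,
    (∀ y ∈ univVars Φ.pfx, strictPrec Φ.pfx y x → τ y = τ' y) → σ x τ = σ x τ'

/-- The total assignment `⟨σ, τ⟩` induced by an ∃-strategy `σ` and an
assignment `τ` to the universal variables. -/
def playE (Φ : QBC) (σ : ℕ → (ℕ → Bool) → Bool) (τ : ℕ → Bool) : ℕ → Bool :=
  fun v => if v ∈ existVars Φ.pfx then σ v τ else τ v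

/-- `σ` is a winning ∃-strategy of the prefix of `Φ` for the matrix `M`. -/
def ModelOf (Φ : QBC) (M : (ℕ → Bool) → Prop) (σ : ℕ → (ℕ → Bool) → Bool) : Prop :=
  IsExStrategy Φ σ ∧ ∀ τ : ℕ → Bool, M (playE Φ σ τ)

/-- A model of `Φ` (a winning ∃-strategy). -/
def QBC.Model (Φ : QBC) (σ : ℕ → (ℕ → Bool) → Bool) : Prop :=
  ModelOf Φ Φ.matrix σ

/-- `σ` is a model of `P : C`, where `P` is the prefix of `Φ` and `C` is a
clause (represented by its falsifying assignment). -/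
def ModelOfClause (Φ : QBC) (σ : ℕ → (ℕ → Bool) → Bool) (C : PA) : Prop :=
  ModelOf Φ (fun g => ¬ TotalExtends g C) σ

/-- `C` is an axiom of `Φ`: a clause on the variables of `Φ` such that every
model of `Φ` is a model of `P : C`. -/
def IsAxiom (Φ : QBC) (C : PA) : Prop :=
  (∀ v, C v ≠ none → v ∈ Φ.vars) ∧ ∀ σ, Φ.Model σ → ModelOfClause Φ σ C

/-- An axiom set of `Φ`. -/
def IsAxiomSet (Φ : QBC) (H : Set PA) : Prop := ∀ C ∈ H, IsAxiom Φ C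

/-- A ∀-strategy: response functions for the universal variables, each
depending only on the existential variables strictly preceding it. -/
def IsUnivStrategy (Φ : QBC) (τ : ℕ → (ℕ → Bool) → Bool) : Prop :=
  ∀ y ∈ univVars Φ.pfx, ∀ σ σ' : ℕ → Bool,
    (∀ x ∈ existVars Φ.pfx, strictPrec Φ.pfx x y → σ x = σ' x) → τ y σ = τ y σ'

/-- The total assignment `⟨τ, σ⟩` induced by a ∀-strategy `τ` and an
assignment `σ` to the existential variables. -/
def playU (Φ : QBC) (τ : ℕ → (ℕ → Bool) → Bool) (σ : ℕ → Bool) : ℕ → Bool :=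
  fun v => if v ∈ univVars Φ.pfx then τ v σ else σ v

/-- A winning ∀-strategy: every play falsifies the matrix. -/
def WinningUnivStrategy (Φ : QBC) (τ : ℕ → (ℕ → Bool) → Bool) : Prop :=
  IsUnivStrategy Φ τ ∧ ∀ σ : ℕ → Bool, ¬ Φ.matrix (playU Φ τ σ)

/-- `C` is obtainable from `D` by ∀-elimination (relative to prefix `P`):
`C = D ∖ {L}` for a literal `L` on a universal variable `y` with
`vars(C) ⪯ y`.  In assignment form: `D` is `C` additionally defined on `y`. -/
def ForallElim (P : List (Quant × ℕ)) (C D : PA) : Prop :=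
  ∃ y b, y ∈ univVars P ∧ C y = none ∧ D = Function.update C y (some b) ∧
    ∀ u, C u ≠ none → preceq P u y

/-- `γ` is the resolvent of `α` and `β` on variable `v` (in falsifying
assignment form: `α` and `β` carry complementary literals on `v`, `γ` is
the union of the remainders, which must be a clause). -/
def IsResolvent (γ α β : PA) (v : ℕ) : Prop :=
  ∃ b, α v = some b ∧ β v = some (!b) ∧ γ v = none ∧
    (∀ u, u ≠ v → γ u = (α u).elim (β u) some) ∧
    (∀ u, u ≠ v → ∀ b₁ b₂, α u = some b₁ → β u = some b₂ → b₁ = b₂)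

/-- A step in a QU-resolution proof: an axiom, a ∀-elimination (annotated with
the index of its source), or a resolution step (annotated with the indices of
its two sources and the resolved variable). -/
inductive QUStep where
  | ax (C : PA)
  | elim (C : PA) (src : ℕ)
  | res (C : PA) (src₁ src₂ : ℕ) (v : ℕ)

/-- The clause of a proof step. -/
def QUStep.clause : QUStep → PA
  | .ax C => C
  | .elim C _ => C
  | .res C _ _ _ => C

/-- The clause at position `i` of a proof. -/
def stepClause? (L : List QUStep) (i : ℕ) : Option PA := (L[i]?).map QUStep.clause

/-- Validity of the `i`-th step of a proof from axiom set `H`. -/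
def validStep (P : List (Quant × ℕ)) (H : Set PA) (L : List QUStep) (i : ℕ) : Prop :=
  match L[i]? with
  | none => True
  | some (.ax C) => C ∈ H
  | some (.elim C j) => j < i ∧ ∃ D, stepClause? L j = some D ∧ ForallElim P C D
  | some (.res C j k v) => j < i ∧ k < i ∧
      ∃ α β, stepClause? L j = some α ∧ stepClause? L k = some β ∧ IsResolvent C α β v

/-- A QU-resolution proof of `Φ` from axiom set `H`. -/
def IsQUProof (Φ : QBC) (H : Set PA) (L : List QUStep) : Prop :=
  ∀ i, validStep Φ.pfx H L i

/-- A QU-resolution falsity proof: a proof ending with the empty clause. -/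
def IsFalsityProof (Φ : QBC) (H : Set PA) (L : List QUStep) : Prop :=
  IsQUProof Φ H L ∧ (L.getLast?).map QUStep.clause = some emptyPA

/-- The clause `C` appears in the proof `L`. -/
def AppearsIn (L : List QUStep) (C : PA) : Prop := ∃ i, stepClause? L i = some C

/-- The edge relation of the graph `G(π)`: an edge from each clause occurrence
to the clause occurrence(s) from which it is derived. -/
def edge (L : List QUStep) (i j : ℕ) : Prop :=
  match L[i]? with
  | some (.elim _ s) => j = s
  | some (.res _ s t _) => j = s ∨ j = t
  | _ => False

/-- A sink (leaf) of `G(π)`: a vertex with no outgoing edges. -/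
def isSink (L : List QUStep) (i : ℕ) : Prop := i < L.length ∧ ∀ j, ¬ edge L i j

/-- The proof is tree-like: `G(π)` is a tree (each vertex has at most one
incoming edge; acyclicity holds automatically since edges decrease indices). -/
def TreeLike (L : List QUStep) : Prop := ∀ j : ℕ, {i | edge L i j}.Subsingleton

-- The prefix `P[a]`: the variables of `dom a` are removed, and the
-- quantifier of every variable strictly preceding some variable of `dom a`
-- (equivalently, every `v` with `v ⪯ last(a)` and not `last(a) ⪯ v`) is
-- changed to `∃`.
open Classical in
noncomputable def instPrefix (P : List (Quant × ℕ)) (a : PA) : List (Quant × ℕ) :=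
  (P.filter fun p => (a p.2).isNone).map fun p =>
    (if ∃ u, a u ≠ none ∧ strictPrec P p.2 u then Quant.ex else p.1, p.2)

/-- Overriding a total assignment by a partial assignment. -/
def override (a : PA) (g : ℕ → Bool) : ℕ → Bool := fun v => (a v).getD (g v)

/-- The instantiated QBC `Φ[a]` = `P[a] : φ[a]`. -/
noncomputable def QBC.inst (Φ : QBC) (a : PA) : QBC :=
  ⟨instPrefix Φ.pfx a, fun g => Φ.matrix (override a g)⟩

/-- `P'` is a relaxation of the prefix `P`: a permutation of `P` such that
`y ⪯ x` implies `y ⪯' x` for every universal `y` and existential `x`. -/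
def IsRelaxationPfx (P P' : List (Quant × ℕ)) : Prop :=
  P.Perm P' ∧ ∀ y ∈ univVars P, ∀ x ∈ existVars P, preceq P y x → preceq P' y x

/-- `Φ'` is a relaxation of the QBC `Φ`. -/
def IsRelaxation (Φ Φ' : QBC) : Prop :=
  IsRelaxationPfx Φ.pfx Φ'.pfx ∧ Φ'.matrix = Φ.matrix

/-- Negation of a quantifier. -/
def Quant.neg : Quant → Quant
  | .all => .ex
  | .ex => .all

/-- `isAltFrom q i qs`: the quantifier string `qs` consists of (at most) `i`
alternating possibly-empty blocks, starting with a block of `q`s. -/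
def isAltFrom : Quant → ℕ → List Quant → Prop
  | _, 0, qs => qs = []
  | q, i + 1, qs => ∃ k rest, qs = List.replicate k q ++ rest ∧ isAltFrom q.neg i rest

/-- The prefix `P` is `Π_i`: its quantifier string lies in `∀*∃*∀*⋯` with `i`
alternating starred blocks beginning with `∀*`. -/
def isPiPrefix (i : ℕ) (P : List (Quant × ℕ)) : Prop :=
  isAltFrom Quant.all i (P.map Prod.fst)

/-- The axiom set `H(Φ, Π_k)`: the clauses `C` on variables of `Φ` such that
some `Π_k`-relaxation of `Φ[assign(C)]` is false. -/
def Hset (Φ : QBC) (k : ℕ) : Set PA :=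
  {C | (∀ v, C v ≠ none → v ∈ Φ.vars) ∧
    ∃ Φ' : QBC, IsRelaxation (Φ.inst C) Φ' ∧ isPiPrefix k Φ'.pfx ∧ Φ'.IsFalse}

/-- `g` is a semicompletion of `f` (relative to prefix `P`). -/
def SemiComp (P : List (Quant × ℕ)) (f g : PA) : Prop :=
  ExtendsPA g f ∧
  ∀ y ∈ univVars P, f y = none → domPrec P f y → (g y = none ∧ domPrec P g y)

/-- A set of partial assignments of `Φ` is semicompletion-closed. -/
def SemiCompClosed (Φ : QBC) (H : Set PA) : Prop :=
  ∀ f ∈ H, ∀ g : PA, (∀ v, g v ≠ none → v ∈ Φ.vars) → SemiComp Φ.pfx f g → g ∈ H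

/-- Delayer condition (semicompletion-of-empty). -/
def CondEmpty (Φ : QBC) (F : Set PA) (s : PA → ℕ) : Prop :=
  ∃ g ∈ F, SemiComp Φ.pfx emptyPA g ∧ s g = 0

/-- Delayer condition (monotonicity). -/
def CondMono (Φ : QBC) (F : Set PA) (s : PA → ℕ) : Prop :=
  ∀ g ∈ F, ∀ f' : PA, ExtendsPA g f' → ∃ f ∈ F, SemiComp Φ.pfx f' f ∧ s f ≤ s g

/-- Delayer condition (∀-branching). -/
def CondForallB (Φ : QBC) (F : Set PA) (s : PA → ℕ) : Prop :=
  ∀ f ∈ F, ∀ y ∈ univVars Φ.pfx, f y = none → domPrec Φ.pfx f y →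
    ∀ b : Bool, ∃ g ∈ F, SemiComp Φ.pfx (Function.update f y (some b)) g ∧ s g = s f

/-- Delayer condition (double-branching). -/
def CondDoubleB (Φ : QBC) (F : Set PA) (s : PA → ℕ) : Prop :=
  ∀ f ∈ F, ∀ v ∈ Φ.vars, f v = none →
    ∃ b : Bool, ∃ g ∈ F, SemiComp Φ.pfx (Function.update f v (some b)) g ∧
      s g ≤ s f + 1 ∧
      (s g = s f + 1 →
        ∃ g' ∈ F, SemiComp Φ.pfx (Function.update f v (some (!b))) g' ∧ s g' ≤ s f + 1)

/-- A `p`-point delayer strategy for `Φ` with respect to axiom set `H`. -/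
def IsDelayer (Φ : QBC) (H : Set PA) (p : ℕ) (F : Set PA) (s : PA → ℕ) : Prop :=
  (∀ f ∈ F, ∀ v, f v ≠ none → v ∈ Φ.vars) ∧
  CondEmpty Φ F s ∧ (∀ f ∈ F, f ∈ H → p ≤ s f) ∧
  CondMono Φ F s ∧ CondForallB Φ F s ∧ CondDoubleB Φ F s

/-! The separation formulas `Φₙ` of Section 6. -/

/-- The variable `x_{i,j,k}`. -/
def xV (i : ℕ) (j k : Bool) : ℕ := 9 * i + 2 * cond j 1 0 + cond k 1 0

/-- The variable `x'_{i,j,k}`. -/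
def xV' (i : ℕ) (j k : Bool) : ℕ := 9 * i + 4 + 2 * cond j 1 0 + cond k 1 0

/-- The variable `yᵢ`. -/
def yV (i : ℕ) : ℕ := 9 * i + 8

/-- A block of four quantified variables. -/
def blockOf (q : Quant) (f : Bool → Bool → ℕ) : List (Quant × ℕ) :=
  [(q, f false false), (q, f false true), (q, f true false), (q, f true true)]

/-- The prefix `∃X₀ ∃X'₁∀y₁∃X₁ ⋯ ∃X'ₙ∀yₙ∃Xₙ`. -/
def sepPrefix (n : ℕ) : List (Quant × ℕ) :=
  blockOf Quant.ex (xV 0) ++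
    (List.range n).flatMap fun i =>
      blockOf Quant.ex (xV' (i + 1)) ++ [(Quant.all, yV (i + 1))] ++
        blockOf Quant.ex (xV (i + 1))

/-- The clause `¬x_{0,j,k}` (as its falsifying assignment). -/
def clB1 (j k : Bool) : PA := fun v => if v = xV 0 j k then some true else none

/-- The clause `x_{n,j,0} ∨ x_{n,j,1}`. -/
def clB2 (n : ℕ) (j : Bool) : PA :=
  fun v => if v = xV n j false ∨ v = xV n j true then some false else none

/-- The clause `¬x'_{i,0,k} ∨ ¬x'_{i,1,l} ∨ x_{i−1,j,0} ∨ x_{i−1,j,1}`. -/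
def clH (i : ℕ) (j k l : Bool) : PA := fun v =>
  if v = xV' i false k ∨ v = xV' i true l then some true
  else if v = xV (i - 1) j false ∨ v = xV (i - 1) j true then some false
  else none

/-- For `j = false` the clause `¬x_{i,0,k} ∨ yᵢ ∨ x'_{i,0,k}`; for `j = true`
the clause `¬x_{i,1,k} ∨ ¬yᵢ ∨ x'_{i,1,k}`. -/
def clT (i : ℕ) (j k : Bool) : PA := fun v =>
  if v = xV i j k then some true
  else if v = yV i then some j
  else if v = xV' i j k then some false
  else none

/-- The set `Tᵢ` of clauses. -/
def Tset (i : ℕ) : Set PA := {C | ∃ j k : Bool, C = clT i j k}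

/-- The set of clauses of the matrix `φₙ`. -/
def sepClauses (n : ℕ) : Set PA :=
  {C | (∃ j k : Bool, C = clB1 j k) ∨ (∃ j : Bool, C = clB2 n j) ∨
    (∃ i, 1 ≤ i ∧ i ≤ n ∧ ∃ j k l : Bool, C = clH i j k l) ∨
    (∃ i, 1 ≤ i ∧ i ≤ n ∧ ∃ j k : Bool, C = clT i j k)}

/-- The separation formula `Φₙ`. -/
def sepQBC (n : ℕ) : QBC :=
  ⟨sepPrefix n, fun g => ∀ C ∈ sepClauses n, ¬ TotalExtends g C⟩

/-- The level-`i` variables `X'ᵢ ∪ {yᵢ} ∪ Xᵢ`. -/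
def levelVars (i : ℕ) : List ℕ :=
  [xV' i false false, xV' i false true, xV' i true false, xV' i true true, yV i,
   xV i false false, xV i false true, xV i true false, xV i true true]

/-- `r` is defined exactly on the level-`i` variables. -/
def OnLevel (i : ℕ) (r : PA) : Prop := ∀ v, r v ≠ none ↔ v ∈ levelVars i

/-- A normal realization of level `i`. -/
def NormalReal (i : ℕ) (r : PA) : Prop :=
  OnLevel i r ∧ ∃ b : Bool, r (yV i) = some b ∧
    r (xV i b false) = some false ∧ r (xV' i b false) = some false ∧
    r (xV i b true) = some false ∧ r (xV' i b true) = some false ∧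
    ∃ c : Bool, r (xV i (!b) false) = some c ∧ r (xV' i (!b) false) = some c ∧
      r (xV i (!b) true) = some (!c) ∧ r (xV' i (!b) true) = some (!c)

/-- A funny realization of level `i`. -/
def FunnyReal (i : ℕ) (r : PA) : Prop :=
  OnLevel i r ∧ ∃ b : Bool, r (yV i) = some b ∧
    (∃ c : Bool, r (xV i b false) = some c ∧ r (xV' i b false) = some c ∧
      r (xV i b true) = some (!c) ∧ r (xV' i b true) = some (!c)) ∧
    r (xV' i (!b) false) = some false ∧ r (xV' i (!b) true) = some false ∧
    ∃ d : Bool, r (xV i (!b) false) = some d ∧ r (xV i (!b) true) = some (!d)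

/-- Restriction of a partial assignment to the level-`i` variables. -/
def restrictLevel (i : ℕ) (f : PA) : PA :=
  fun v => if v ∈ levelVars i then f v else none

-- The maximum level `ℓ` containing an existentially quantified variable of
-- `dom f` (and `0` if there is none).
open Classical in
noncomputable def maxLevel (n : ℕ) (f : PA) : ℕ :=
  ((Finset.Icc 1 n).filter fun i => ∃ v ∈ levelVars i, v ≠ yV i ∧ f v ≠ none).sup id

/-- `f` is half-defined on level `ℓ`. -/
def HalfDefined (ℓ : ℕ) (f : PA) : Prop :=
  (∀ j k : Bool, f (xV ℓ j k) = none) ∧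
  (∃ j k : Bool, f (xV' ℓ j k) = some true ∧
    ∀ j' k' : Bool, (j', k') ≠ (j, k) → f (xV' ℓ j' k') = some false)

/-- A normal assignment of `Φₙ`. -/
def NormalAssign (n : ℕ) (f : PA) : Prop :=
  (∀ v, f v ≠ none → v ∈ (sepPrefix n).map Prod.snd) ∧
  (∀ j k : Bool, f (xV 0 j k) = some false) ∧
  (∀ i, 1 ≤ i → i + 1 ≤ maxLevel n f → NormalReal i (restrictLevel i f)) ∧
  (1 ≤ maxLevel n f →
    (NormalReal (maxLevel n f) (restrictLevel (maxLevel n f) f) ∨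
      HalfDefined (maxLevel n f) f))

/-- A funny assignment of `Φₙ`, with witness `m` (so that `sₙ(f) = m`). -/
def FunnyAssign (n : ℕ) (f : PA) (m : ℕ) : Prop :=
  (∀ v, f v ≠ none → v ∈ (sepPrefix n).map Prod.snd) ∧
  1 ≤ m ∧ m ≤ maxLevel n f ∧
  (∀ j k : Bool, f (xV 0 j k) = some false) ∧
  (∀ i, 1 ≤ i → i < m → NormalReal i (restrictLevel i f)) ∧
  FunnyReal m (restrictLevel m f) ∧
  (∀ i, m < i → i ≤ maxLevel n f → ∀ j : Bool,
    ((f (xV i j false) ≠ none ∨ f (xV i j true) ≠ none ∨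
      f (xV' i j false) ≠ none ∨ f (xV' i j true) ≠ none) →
      ∃ c : Bool, f (xV i j false) = some c ∧ f (xV' i j false) = some c ∧
        f (xV i j true) = some (!c) ∧ f (xV' i j true) = some (!c)))

/-- The set `Fₙ` of normal and funny assignments. -/
def Fset (n : ℕ) : Set PA := {f | NormalAssign n f ∨ ∃ m, FunnyAssign n f m}

-- The score function `sₙ`.
open Classical in
noncomputable def score (n : ℕ) (f : PA) : ℕ :=
  if h : ∃ m, FunnyAssign n f m then h.choose else maxLevel n f

/-! The mod-3 formulas `Ψₙ` of Section 7 (variables `xᵢ = 2i`, `yᵢ = 2i+1`). -/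

/-- The prefix `∃x₁∀y₁⋯∃xₙ∀yₙ`. -/
def modPrefix (n : ℕ) : List (Quant × ℕ) :=
  (List.range n).flatMap fun i =>
    [(Quant.ex, 2 * (i + 1)), (Quant.all, 2 * (i + 1) + 1)]

/-- Numeric value of a Boolean. -/
def boolVal (b : Bool) : ℕ := cond b 1 0

/-- The matrix `φ_{n,j}`: true iff `j + Σᵢ (xᵢ + yᵢ) ≢ n (mod 3)`. -/
def modMatrix (n j : ℕ) (g : ℕ → Bool) : Prop :=
  ¬ ((j + ∑ i ∈ Finset.Icc 1 n, (boolVal (g (2 * i)) + boolVal (g (2 * i + 1)))) % 3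
      = n % 3)

/-- The mod-3 formula `Ψₙ`. -/
def modQBC (n : ℕ) : QBC := ⟨modPrefix n, modMatrix n 0⟩

/-- Existential strategies with suitable dependencies witness `evalQ`. -/
lemma evalQ_of_strategy (s : ℕ → (ℕ → Bool) → Bool) (D : ℕ → ℕ → Prop)
    (hs : ∀ x h h', (∀ y, D y x → h y = h' y) → s x h = s x h')
    (hirr : ∀ x, ¬ D x x) (φ : (ℕ → Bool) → Prop) :
    ∀ (R : List (Quant × ℕ)) (g : ℕ → Bool),
      R.Pairwise (fun p q => p.2 ≠ q.2 ∧ ¬ D q.2 p.2) →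
      (∀ h : ℕ → Bool, (∀ v, v ∉ R.map Prod.snd → h v = g v) →
        (∀ x, (Quant.ex, x) ∈ R → h x = s x h) → φ h) →
      evalQ R φ g := by
  intro R
  induction R with
  | nil =>
    intro g _ H
    exact H g (fun _ _ => rfl) (by simp)
  | cons p R ih =>
    intro g hp H
    obtain ⟨q, x⟩ := p
    rw [List.pairwise_cons] at hp
    obtain ⟨hp1, hp2⟩ := hp
    have hx : x ∉ R.map Prod.snd := by
      intro hm
      obtain ⟨r, hr, hrx⟩ := List.mem_map.1 hm
      exact (hp1 r hr).1 hrx.symm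
    have hout : ∀ (b : Bool) (h : ℕ → Bool),
        (∀ v, v ∉ R.map Prod.snd → h v = Function.update g x b v) →
        ∀ v, v ∉ (((q, x) :: R).map Prod.snd) → h v = g v := by
      intro b h hh v hv
      simp only [List.map_cons, List.mem_cons, not_or] at hv
      rw [hh v hv.2, Function.update_of_ne hv.1]
    cases q with
    | all =>
      intro b
      apply ih _ hp2
      intro h hh hex
      apply H h (hout b h hh)
      intro z hz
      rcases List.mem_cons.1 hz with hz | hz
      · cases hz
      · exact hex z hz
    | ex =>
      refine ⟨s x g, ?_⟩
      apply ih _ hp2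
      intro h hh hex
      apply H h (hout _ h hh)
      intro z hz
      rcases List.mem_cons.1 hz with hz | hz
      · cases hz
        rw [hh x hx, Function.update_self]
        apply hs
        intro y hy
        have hyx : y ≠ x := by
          rintro rfl
          exact hirr _ hy
        have hyR : y ∉ R.map Prod.snd := by
          intro hm
          obtain ⟨r, hr, hrx⟩ := List.mem_map.1 hm
          exact (hp1 r hr).2 (hrx ▸ hy)
        rw [hh y hyR, Function.update_of_ne hyx]
      · exact hex z hz

lemma pairwise_not_strictPrec (P : List (Quant × ℕ)) :
    P.Pairwise (fun p q => ¬ strictPrec P q.2 p.2) := by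
  rw [List.pairwise_iff_getElem]
  intro i j hi hj hij hst
  exact hst.2 ⟨i, j, by simp [hi], by simp [hj], Or.inl hij.le⟩

theorem instantiation_gives_axiom (Φ : QBC) (hΦ : Φ.WellFormed) (a : PA)
    (ha : ∀ v, a v ≠ none → v ∈ Φ.vars) (hfalse : (Φ.inst a).IsFalse) :
    ∀ σ, Φ.Model σ → ModelOfClause Φ σ a := by
  classical
  intro σ hσ
  refine ⟨hσ.1, ?_⟩
  intro τ hext
  apply hfalse
  intro g
  let T : (ℕ → Bool) → ℕ → Bool := fun h y =>
    if a y ≠ none ∨ ∃ u, a u ≠ none ∧ strictPrec Φ.pfx y u then τ y else h y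
  let s : ℕ → (ℕ → Bool) → Bool := fun x h =>
    if x ∈ existVars Φ.pfx then σ x (T h) else τ x
  refine evalQ_of_strategy s (strictPrec Φ.pfx) ?_ (fun x h => h.2 h.1) _ _ _ ?_ ?_
  · intro x h h' hh
    by_cases hx : x ∈ existVars Φ.pfx
    · simp only [s, if_pos hx]
      apply hσ.1 x hx
      intro y _ hyx
      simp only [T, hh y hyx]
    · simp only [s, if_neg hx]
  · have h1 : Φ.pfx.Pairwise (fun p q => p.2 ≠ q.2) := List.pairwise_map.1 hΦ.1
    have h2 := h1.and (pairwise_not_strictPrec Φ.pfx)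
    exact List.pairwise_map.2 (h2.filter _)
  · intro h _ hex
    have hmem : ∀ q v, (q, v) ∈ Φ.pfx → a v = none →
        (q = Quant.ex ∨ ∃ u, a u ≠ none ∧ strictPrec Φ.pfx v u) → h v = s v h := by
      intro q v hv hav hq
      apply hex
      refine List.mem_map.2 ⟨(q, v), List.mem_filter.2 ⟨hv, by simp [hav]⟩, ?_⟩
      rcases hq with hq | hq
      · subst hq; simp
      · rw [if_pos hq]
    have hplay := hσ.2 (T h)
    refine (hΦ.2 _ _ ?_).1 hplay
    intro v hv
    obtain ⟨⟨q, w⟩, hqv, rfl⟩ := List.mem_map.1 hv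
    simp only [playE, override]
    by_cases hx : w ∈ existVars Φ.pfx
    · rw [if_pos hx]
      cases hav : a w with
      | some b =>
        have h1 := hext w b hav
        simp only [playE, if_pos hx] at h1
        rw [Option.getD_some, ← h1]
        apply hσ.1 w hx
        intro y _ hy
        exact if_pos (Or.inr ⟨w, by simp [hav], hy⟩)
      | none =>
        have h2 : (Quant.ex, w) ∈ Φ.pfx := by
          simpa [existVars] using hx
        rw [Option.getD_none, hmem _ w h2 hav (Or.inl rfl)]
        simp only [s, if_pos hx]
    · rw [if_neg hx]
      cases hav : a w with
      | some b =>
        have h1 := hext w b hav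
        simp only [playE, if_neg hx] at h1
        rw [Option.getD_some, ← h1]
        exact if_pos (Or.inl (by simp [hav]))
      | none =>
        rw [Option.getD_none]
        by_cases hu : ∃ u, a u ≠ none ∧ strictPrec Φ.pfx w u
        · rw [hmem q w hqv hav (Or.inr hu)]
          simp only [s, if_neg hx]
          exact if_pos (Or.inr hu)
        · exact if_neg (by simpa [hav] using hu)
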